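/- For any ordinal δ, there is no sequence ⟨M_α : α < δ⁺⟩ of transitive models of ZFC of height δ together with a commuting system of elementary embeddings j_{α,β} : M_α → M_β (for α ≤ β < δ⁺, with j_{α,γ} = j_{β,γ} ∘ j_{α,β}) in which all the embeddings j_{α,β} for α < β are nontrivial. -/

import Mathlib

open FirstOrder FirstOrder.Language

/-- The language of set theory: one binary relation symbol. -/
def ZFLang : FirstOrder.Language :=
  ⟨fun _ => Empty, fun n => match n with | 2 => Unit | _ => Empty⟩

def memRel : ZFLang.Relations 2 := ()

/-- The membership structure on a class of ZF-sets. -/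
noncomputable instance zfStr (M : Set ZFSet) : ZFLang.Structure ↥M where
  funMap {n} f _ := f.elim
  RelMap {n} r v :=
    match n, r, v with
    | 2, _, v => ((v 0 : ↥M) : ZFSet) ∈ ((v 1 : ↥M) : ZFSet)
    | 0, r, _ => r.elim
    | 1, r, _ => r.elim
    | (_+3), r, _ => r.elim

/-- The formula `x ∈ y`. -/
def mem' {n : ℕ} (x y : Fin n) : ZFLang.BoundedFormula Empty n :=
  Relations.boundedFormula₂ memRel (Term.var (Sum.inr x)) (Term.var (Sum.inr y))

/-- The formula `x = y`. -/
def eq' {n : ℕ} (x y : Fin n) : ZFLang.BoundedFormula Empty n :=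
  Term.bdEqual (Term.var (Sum.inr x)) (Term.var (Sum.inr y))

def extAx : ZFLang.Sentence :=
  ∀' ∀' ((∀' (mem' 2 0 ⇔ mem' 2 1)) ⟹ eq' 0 1)

def pairAx : ZFLang.Sentence :=
  ∀' ∀' ∃' ∀' (mem' 3 2 ⇔ (eq' 3 0 ⊔ eq' 3 1))

def unionAx : ZFLang.Sentence :=
  ∀' ∃' ∀' (mem' 2 1 ⇔ ∃' (mem' 3 0 ⊓ mem' 2 3))

def powerAx : ZFLang.Sentence :=
  ∀' ∃' ∀' (mem' 2 1 ⇔ ∀' (mem' 3 2 ⟹ mem' 3 0))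

def infAx : ZFLang.Sentence :=
  ∃' ((∃' (mem' 1 0 ⊓ ∀' (∼(mem' 2 1)))) ⊓
    (∀' (mem' 1 0 ⟹ ∃' (mem' 2 0 ⊓ ∀' (mem' 3 2 ⇔ (mem' 3 1 ⊔ eq' 3 1))))))

def foundAx : ZFLang.Sentence :=
  ∀' ((∃' (mem' 1 0)) ⟹ ∃' (mem' 1 0 ⊓ ∀' (mem' 2 1 ⟹ ∼(mem' 2 0))))

/-- The separation axiom for a formula with `k` parameters. -/
def sepAx {k : ℕ} (φ : ZFLang.BoundedFormula Empty (k + 1)) : ZFLang.Sentence :=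
  (mem' ⟨k+2, by omega⟩ ⟨k+1, by omega⟩ ⇔
      (mem' ⟨k+2, by omega⟩ ⟨k, by omega⟩ ⊓ φ.liftAt 2 k)).all.ex.all.alls

/-- The collection axiom for a formula with `k` parameters. -/
def collAx {k : ℕ} (φ : ZFLang.BoundedFormula Empty (k + 2)) : ZFLang.Sentence :=
  (mem' ⟨k+2, by omega⟩ ⟨k, by omega⟩ ⟹
      ((φ.liftAt 2 k).ex ⟹
        ((mem' ⟨k+3, by omega⟩ ⟨k+1, by omega⟩ ⊓ φ.liftAt 2 k).ex))).all.ex.all.alls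

def choiceAx : ZFLang.Sentence :=
  (((∀' ((mem' 1 0) ⟹ (∃' (mem' 2 1)))) ⊓
    (∀' ∀' ((((mem' 1 0) ⊓ (mem' 2 0)) ⊓ (∼(eq' 1 2))) ⟹ (∀' (∼((mem' 3 1) ⊓ (mem' 3 2)))))))
   ⟹
   (∃' ∀' ((mem' 2 0) ⟹
      (∃' (((mem' 3 2) ⊓ (mem' 3 1)) ⊓
        (∀' (((mem' 4 2) ⊓ (mem' 4 1)) ⟹ (eq' 4 3)))))))).all

/-- The ZFC axioms: extensionality, pairing, union, powerset, infinity, foundation, choice,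
separation, and collection. -/
def ZFCTheory : ZFLang.Theory :=
  {extAx, pairAx, unionAx, powerAx, infAx, foundAx, choiceAx} ∪
    (⋃ (k : ℕ), Set.range (@sepAx k)) ∪ (⋃ (k : ℕ), Set.range (@collAx k))

/-- A class of ZF-sets is transitive. -/
def SetTransitive (M : Set ZFSet) : Prop := ∀ x ∈ M, ∀ y : ZFSet, y ∈ x → y ∈ M

/-- A transitive model of ZFC. -/
def IsZFCModel (M : Set ZFSet) : Prop := SetTransitive M ∧ ZFCTheory.Model ↥M

/-- Two classes have the same ordinals. -/
def SameOrdinals (M N : Set ZFSet) : Prop :=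
  ∀ x : ZFSet, x.IsOrdinal → (x ∈ M ↔ x ∈ N)

/-- `z` is the pointwise image `j[x]` of `x` under `j`. -/
def ImageSet (M N : Set ZFSet) (j : ↥M → ↥N) (x z : ZFSet) : Prop :=
  ∀ w : ZFSet, w ∈ z ↔ ∃ y : ↥M, (y : ZFSet) ∈ x ∧ ((j y : ↥N) : ZFSet) = w

/-- `j : M → N` is amenable: every pointwise image `j[x]`, `x ∈ M`, belongs to `N`. -/
def Amenable (M N : Set ZFSet) (j : ↥M → ↥N) : Prop :=
  ∀ x ∈ M, ∃ z ∈ N, ImageSet M N j x z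

/-- `κ` is the critical point of `j`: the least ordinal moved. -/
def IsCrit (M N : Set ZFSet) (j : ↥M → ↥N) (κ : ZFSet) : Prop :=
  κ.IsOrdinal ∧ ∃ h : κ ∈ M, ((j ⟨κ, h⟩ : ↥N) : ZFSet) ≠ κ ∧
    ∀ β : ZFSet, β ∈ κ → ∀ hb : β ∈ M, ((j ⟨β, hb⟩ : ↥N) : ZFSet) = β

/-- `f` is a cofinal map from `β` into the ordinal `α`. -/
def CofinalIn (β α f : ZFSet) : Prop :=
  ∀ γ, γ ∈ α → ∃ ξ, ξ ∈ β ∧ ∃ η, ξ.pair η ∈ f ∧ (γ ∈ η ∨ γ = η)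

/-- `α` is a regular ordinal from the point of view of the class `M`. -/
def RegularIn (M : Set ZFSet) (α : ZFSet) : Prop :=
  ∀ β, β ∈ α → ∀ f, f ∈ M → ZFSet.IsFunc β α f → ¬ CofinalIn β α f

universe u

section DefinedAlike

variable {M N : Set ZFSet.{u}}

@[simp]
theorem relMap_memRel (v : Fin 2 → ↥M) : Structure.RelMap memRel v ↔ (v 0).1 ∈ (v 1).1 :=
  Iff.rfl

/-- `P` and `Q` are defined over `M` and `N` by the same formula, whose parameters from `M`
are moved along `j` when it is read in `N`. -/
def DefinedAlike (j : ↥M → ↥N) {n : ℕ} (P : (Fin n → ↥M) → Prop) (Q : (Fin n → ↥N) → Prop) :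
    Prop :=
  ∃ φ : ZFLang.BoundedFormula ↥M n,
    (∀ v, φ.Realize id v ↔ P v) ∧ (∀ v, φ.Realize j v ↔ Q v)

/-- `f` and `g` are the same variable, or a parameter and its image under `j`. -/
def NamedAlike (j : ↥M → ↥N) {n : ℕ} (f : (Fin n → ↥M) → ↥M) (g : (Fin n → ↥N) → ↥N) : Prop :=
  ∃ t : ↥M ⊕ Fin n, (∀ v, Sum.elim id v t = f v) ∧ (∀ v, Sum.elim j v t = g v)

variable {j : ↥M → ↥N} {n : ℕ}

theorem NamedAlike.var (i : Fin n) : NamedAlike j (fun v => v i) (fun v => v i) :=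
  ⟨Sum.inr i, fun _ => rfl, fun _ => rfl⟩

theorem NamedAlike.const (c : ↥M) :
    NamedAlike j (n := n) (fun _ => c) (fun _ => j c) :=
  ⟨Sum.inl c, fun _ => rfl, fun _ => rfl⟩

theorem NamedAlike.constId (c : ↥M) :
    NamedAlike (id : ↥M → ↥M) (n := n) (fun _ => c) (fun _ => c) :=
  ⟨Sum.inl c, fun _ => rfl, fun _ => rfl⟩

theorem NamedAlike.reindex {m : ℕ} {f : (Fin n → ↥M) → ↥M} {g : (Fin n → ↥N) → ↥N}
    {r : Fin n → Fin m} (h : NamedAlike j f g) :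
    NamedAlike j (fun v => f fun i => v (r i)) (fun v => g fun i => v (r i)) := by
  obtain ⟨t | i, h1, h2⟩ := h
  · exact ⟨Sum.inl t, fun v => h1 _, fun v => h2 _⟩
  · exact ⟨Sum.inr (r i), fun v => h1 fun i => v (r i), fun v => h2 fun i => v (r i)⟩

namespace DefinedAlike

variable {P P' : (Fin n → ↥M) → Prop} {Q Q' : (Fin n → ↥N) → Prop}
  {f f' f'' : (Fin n → ↥M) → ↥M} {g g' g'' : (Fin n → ↥N) → ↥N}

theorem mem (h : NamedAlike j f g) (h' : NamedAlike j f' g') :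
    DefinedAlike j (fun v => (f v).1 ∈ (f' v).1) (fun v => (g v).1 ∈ (g' v).1) := by
  obtain ⟨t, h1, h2⟩ := h
  obtain ⟨t', h1', h2'⟩ := h'
  refine ⟨memRel.boundedFormula₂ (Term.var t) (Term.var t'), fun v => ?_, fun v => ?_⟩
  · simp [h1, h1']
  · simp [h2, h2']

theorem eq (h : NamedAlike j f g) (h' : NamedAlike j f' g') :
    DefinedAlike j (fun v => f v = f' v) (fun v => g v = g' v) := by
  obtain ⟨t, h1, h2⟩ := h
  obtain ⟨t', h1', h2'⟩ := h'
  refine ⟨(Term.var t).bdEqual (Term.var t'), fun v => ?_, fun v => ?_⟩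
  · simp [h1, h1']
  · simp [h2, h2']

theorem not (h : DefinedAlike j P Q) : DefinedAlike j (fun v => ¬ P v) (fun v => ¬ Q v) := by
  obtain ⟨φ, h1, h2⟩ := h
  exact ⟨φ.not, by simp [h1], by simp [h2]⟩

theorem imp (h : DefinedAlike j P Q) (h' : DefinedAlike j P' Q') :
    DefinedAlike j (fun v => P v → P' v) (fun v => Q v → Q' v) := by
  obtain ⟨φ, h1, h2⟩ := h
  obtain ⟨ψ, h1', h2'⟩ := h'
  exact ⟨φ.imp ψ, by simp [h1, h1'], by simp [h2, h2']⟩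

theorem and (h : DefinedAlike j P Q) (h' : DefinedAlike j P' Q') :
    DefinedAlike j (fun v => P v ∧ P' v) (fun v => Q v ∧ Q' v) := by
  obtain ⟨φ, h1, h2⟩ := h
  obtain ⟨ψ, h1', h2'⟩ := h'
  exact ⟨φ ⊓ ψ, by simp [h1, h1'], by simp [h2, h2']⟩

theorem or (h : DefinedAlike j P Q) (h' : DefinedAlike j P' Q') :
    DefinedAlike j (fun v => P v ∨ P' v) (fun v => Q v ∨ Q' v) := by
  obtain ⟨φ, h1, h2⟩ := h
  obtain ⟨ψ, h1', h2'⟩ := h'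
  exact ⟨φ ⊔ ψ, by simp [h1, h1'], by simp [h2, h2']⟩

theorem iff (h : DefinedAlike j P Q) (h' : DefinedAlike j P' Q') :
    DefinedAlike j (fun v => P v ↔ P' v) (fun v => Q v ↔ Q' v) := by
  obtain ⟨φ, h1, h2⟩ := h
  obtain ⟨ψ, h1', h2'⟩ := h'
  exact ⟨φ.iff ψ, by simp [h1, h1'], by simp [h2, h2']⟩

theorem all {R : (Fin n → ↥M) → ↥M → Prop} {S : (Fin n → ↥N) → ↥N → Prop}
    (h : DefinedAlike j (n := n + 1) (fun v => R (fun i => v i.castSucc) (v (Fin.last n)))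
      (fun v => S (fun i => v i.castSucc) (v (Fin.last n)))) :
    DefinedAlike j (fun v => ∀ x, R v x) (fun v => ∀ x, S v x) := by
  obtain ⟨φ, h1, h2⟩ := h
  exact ⟨φ.all, by simp [h1], by simp [h2]⟩

theorem ex {R : (Fin n → ↥M) → ↥M → Prop} {S : (Fin n → ↥N) → ↥N → Prop}
    (h : DefinedAlike j (n := n + 1) (fun v => R (fun i => v i.castSucc) (v (Fin.last n)))
      (fun v => S (fun i => v i.castSucc) (v (Fin.last n)))) :
    DefinedAlike j (fun v => ∃ x, R v x) (fun v => ∃ x, S v x) := by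
  obtain ⟨φ, h1, h2⟩ := h
  exact ⟨φ.ex, by simp [h1], by simp [h2]⟩

/-- Elementary embeddings preserve sentences with parameters. -/
theorem transfer {j : ↥M ↪ₑ[ZFLang] ↥N} {p q : Prop}
    (h : DefinedAlike (n := 0) j (fun _ => p) (fun _ => q)) : p ↔ q := by
  obtain ⟨φ, h1, h2⟩ := h
  have := j.map_boundedFormula φ id default
  rw [Function.comp_id, Subsingleton.elim (⇑j ∘ default) default] at this
  exact (h1 default).symm.trans (this.symm.trans (h2 default))

end DefinedAlike

/-- `p` satisfies, in `M`, the definition of the Kuratowski pair of `a` and `b`. -/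
def PairIn (p a b : ↥M) : Prop :=
  ∀ z : ↥M, z.1 ∈ p.1 ↔
    ((∀ w : ↥M, w.1 ∈ z.1 ↔ w = a) ∨ (∀ w : ↥M, w.1 ∈ z.1 ↔ w = a ∨ w = b))

/-- `(a, b)` belongs to `f`, from the point of view of `M`. -/
def PairMemIn (a b f : ↥M) : Prop :=
  ∃ p : ↥M, PairIn p a b ∧ p.1 ∈ f.1

/-- `x` is an ordinal from the point of view of `M`. -/
def OrdinalIn (x : ↥M) : Prop :=
  (∀ y : ↥M, y.1 ∈ x.1 → ∀ z : ↥M, z.1 ∈ y.1 → z.1 ∈ x.1) ∧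
    ∀ y : ↥M, y.1 ∈ x.1 → ∀ z : ↥M, z.1 ∈ y.1 → ∀ w : ↥M, w.1 ∈ z.1 → w.1 ∈ y.1

namespace DefinedAlike

variable {f f' f'' : (Fin n → ↥M) → ↥M} {g g' g'' : (Fin n → ↥N) → ↥N}

theorem pairIn (h : NamedAlike j f g) (h' : NamedAlike j f' g') (h'' : NamedAlike j f'' g'') :
    DefinedAlike j (fun v => PairIn (f v) (f' v) (f'' v))
      (fun v => PairIn (g v) (g' v) (g'' v)) := by
  unfold PairIn
  repeat' first
    | exact NamedAlike.var _ | assumption | exact NamedAlike.reindex (by assumption) | apply all | apply iff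
    | apply or | apply mem | apply eq

theorem pairMemIn (h : NamedAlike j f g) (h' : NamedAlike j f' g') (h'' : NamedAlike j f'' g'') :
    DefinedAlike j (fun v => PairMemIn (f v) (f' v) (f'' v))
      (fun v => PairMemIn (g v) (g' v) (g'' v)) := by
  unfold PairMemIn
  repeat' first
    | exact NamedAlike.var _ | assumption | exact NamedAlike.reindex (by assumption) | apply ex | apply and
    | apply pairIn | apply mem

theorem ordinalIn (h : NamedAlike j f g) :
    DefinedAlike j (fun v => OrdinalIn (f v)) (fun v => OrdinalIn (g v)) := by
  unfold OrdinalIn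
  repeat' first
    | exact NamedAlike.var _ | assumption | exact NamedAlike.reindex (by assumption) | apply and | apply all
    | apply imp | apply mem

end DefinedAlike

end DefinedAlike

section Model

variable {M : Set ZFSet.{u}}

/-- Replace the parameters of a formula by finitely many leading variables. -/
theorem exists_realize_append_iff {n : ℕ} (φ : ZFLang.BoundedFormula ↥M n) :
    ∃ (k : ℕ) (p : Fin k → ↥M) (ψ : ZFLang.BoundedFormula Empty (k + n)),
      ∀ v : Fin n → ↥M, ψ.Realize default (Fin.append p v) ↔ φ.Realize id v := by
  classical
  let e := φ.freeVarFinset.equivFin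
  refine ⟨_, fun i => (e.symm i).1,
    (φ.restrictFreeVar (β := Fin φ.freeVarFinset.card) e).relabel Sum.inr, fun v => ?_⟩
  rw [BoundedFormula.realize_relabel, BoundedFormula.realize_restrictFreeVar id]
  · congr! 1
    ext i
    simp
  · intro a
    simp

theorem IsZFCModel.separation (hM : IsZFCModel M) {P : ↥M → Prop}
    (hP : DefinedAlike (id : ↥M → ↥M) (n := 1) (fun v => P (v 0)) (fun v => P (v 0))) (a : ↥M) :
    ∃ b : ↥M, ∀ x : ↥M, x.1 ∈ b.1 ↔ x.1 ∈ a.1 ∧ P x := by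
  obtain ⟨φ, hφ, -⟩ := hP
  obtain ⟨k, p, ψ, hψ⟩ := exists_realize_append_iff φ
  have := hM.2.realize_of_mem (sepAx ψ)
    (Or.inl (Or.inr (Set.mem_iUnion.2 ⟨k, Set.mem_range_self _⟩)))
  rw [sepAx, Sentence.Realize, BoundedFormula.realize_alls] at this
  have := this p a
  rw [BoundedFormula.realize_ex] at this
  obtain ⟨b, hb⟩ := this
  refine ⟨b, fun x => ?_⟩
  have := hb x
  rw [BoundedFormula.realize_iff, BoundedFormula.realize_inf,
    BoundedFormula.realize_liftAt (by omega)] at this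
  have h1 := (hψ fun _ => x).trans (hφ fun _ => x)
  have e : ((Fin.snoc (Fin.snoc (Fin.snoc p a) b) x : Fin (k + 1 + 1 + 1) → ↥M) ∘
      fun i : Fin (k + 1) => if ↑i < k then Fin.castAdd 2 i else Fin.addNat i 2) =
      Fin.append p fun _ : Fin 1 => x := by
    funext i
    refine Fin.addCases (fun i => ?_) (fun i => ?_) i
    · simp [Fin.snoc, show (i : ℕ) < k + 1 + 1 by omega, show (i : ℕ) < k + 1 by omega]
      rfl
    · simp [Fin.snoc]
  rw [e] at this
  have h2 := this.trans (and_congr_right fun _ => h1)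
  simpa [mem', Fin.snoc] using h2

theorem IsZFCModel.collection (hM : IsZFCModel M) {R : ↥M → ↥M → Prop}
    (hR : DefinedAlike (id : ↥M → ↥M) (n := 2) (fun v => R (v 0) (v 1)) (fun v => R (v 0) (v 1)))
    (a : ↥M) :
    ∃ b : ↥M, ∀ x : ↥M, x.1 ∈ a.1 → (∃ y, R x y) → ∃ y : ↥M, y.1 ∈ b.1 ∧ R x y := by
  obtain ⟨φ, hφ, -⟩ := hR
  obtain ⟨k, p, ψ, hψ⟩ := exists_realize_append_iff φ
  have := hM.2.realize_of_mem (collAx ψ)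
    (Or.inr (Set.mem_iUnion.2 ⟨k, Set.mem_range_self _⟩))
  rw [collAx, Sentence.Realize, BoundedFormula.realize_alls] at this
  have := this p a
  rw [BoundedFormula.realize_ex] at this
  obtain ⟨b, hb⟩ := this
  refine ⟨b, fun x => ?_⟩
  have := hb x
  simp only [BoundedFormula.realize_imp, BoundedFormula.realize_ex, BoundedFormula.realize_inf,
    BoundedFormula.realize_liftAt (show k ≤ k + 2 by omega)] at this
  have e : ∀ y, ((Fin.snoc (Fin.snoc (Fin.snoc (Fin.snoc p a) b) x) y :
      Fin (k + 1 + 1 + 1 + 1) → ↥M) ∘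
      fun i : Fin (k + 2) => if ↑i < k then Fin.castAdd 2 i else Fin.addNat i 2) =
      Fin.append p ![x, y] := by
    intro y
    funext i
    refine Fin.addCases (fun i => ?_) (fun i => ?_) i
    · simp [Fin.snoc, show (i : ℕ) < k + 1 + 1 + 1 by omega, show (i : ℕ) < k + 1 + 1 by omega,
        show (i : ℕ) < k + 1 by omega]
      rfl
    · fin_cases i <;> simp [Fin.snoc]
  have h1 := fun y => (hψ ![x, y]).trans (hφ ![x, y])
  simp only [e, h1] at this
  simpa [mem', Fin.snoc] using this

theorem IsZFCModel.ext (hM : IsZFCModel M) {a b : ↥M} (h : ∀ z : ↥M, z.1 ∈ a.1 ↔ z.1 ∈ b.1) :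
    a = b :=
  Subtype.ext <| ZFSet.ext fun z =>
    ⟨fun hz => (h ⟨z, hM.1 _ a.2 _ hz⟩).1 hz, fun hz => (h ⟨z, hM.1 _ b.2 _ hz⟩).2 hz⟩

theorem IsZFCModel.exists_upair (hM : IsZFCModel M) (a b : ↥M) :
    ∃ c : ↥M, ∀ z : ↥M, z.1 ∈ c.1 ↔ z = a ∨ z = b := by
  have := hM.2.realize_of_mem pairAx (by simp [ZFCTheory])
  simp only [pairAx, mem', eq', Sentence.Realize, Formula.Realize] at this
  simpa [Fin.snoc] using this a b

theorem IsZFCModel.exists_sUnion (hM : IsZFCModel M) (a : ↥M) :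
    ∃ c : ↥M, ∀ z : ↥M, z.1 ∈ c.1 ↔ ∃ y : ↥M, y.1 ∈ a.1 ∧ z.1 ∈ y.1 := by
  have := hM.2.realize_of_mem unionAx (by simp [ZFCTheory])
  simp only [unionAx, mem', Sentence.Realize, Formula.Realize] at this
  simpa [Fin.snoc] using this a

theorem IsZFCModel.exists_powerset (hM : IsZFCModel M) (a : ↥M) :
    ∃ c : ↥M, ∀ z : ↥M, z.1 ∈ c.1 ↔ ∀ y : ↥M, y.1 ∈ z.1 → y.1 ∈ a.1 := by
  have := hM.2.realize_of_mem powerAx (by simp [ZFCTheory])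
  simp only [powerAx, mem', Sentence.Realize, Formula.Realize] at this
  simpa [Fin.snoc] using this a

theorem IsZFCModel.exists_transversal (hM : IsZFCModel M) {a : ↥M}
    (h : ∀ y : ↥M, y.1 ∈ a.1 → ∃ z : ↥M, z.1 ∈ y.1)
    (h' : ∀ y y' : ↥M, y.1 ∈ a.1 → y'.1 ∈ a.1 → y ≠ y' → ∀ z : ↥M, z.1 ∈ y.1 → z.1 ∉ y'.1) :
    ∃ c : ↥M, ∀ y : ↥M, y.1 ∈ a.1 → ∃ z : ↥M, (z.1 ∈ y.1 ∧ z.1 ∈ c.1) ∧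
      ∀ w : ↥M, w.1 ∈ y.1 → w.1 ∈ c.1 → w = z := by
  have := hM.2.realize_of_mem choiceAx (by simp [ZFCTheory])
  simp only [choiceAx, mem', eq', Sentence.Realize, Formula.Realize] at this
  rw [BoundedFormula.realize_all] at this
  have := this a
  rw [BoundedFormula.realize_imp] at this
  have := this (by
    simp [Fin.snoc]
    exact ⟨fun y hy hya => by simpa using h ⟨y, hy⟩ hya,
      fun y hy y' hy' h1 h2 h3 z hz h4 => h' ⟨y, hy⟩ ⟨y', hy'⟩ h1 h2 (by simpa using h3) ⟨z, hz⟩ h4⟩)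
  simpa [Fin.snoc] using this

theorem IsZFCModel.exists_insert (hM : IsZFCModel M) (a b : ↥M) :
    ∃ c : ↥M, ∀ z : ↥M, z.1 ∈ c.1 ↔ z = a ∨ z.1 ∈ b.1 := by
  obtain ⟨s, hs⟩ := hM.exists_upair a a
  obtain ⟨t, ht⟩ := hM.exists_upair s b
  obtain ⟨c, hc⟩ := hM.exists_sUnion t
  refine ⟨c, fun z => ?_⟩
  simp only [hc, ht]
  constructor
  · rintro ⟨y, rfl | rfl, h⟩
    · exact Or.inl (by simpa [hs] using h)
    · exact Or.inr h
  · rintro (rfl | h)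
    · exact ⟨s, Or.inl rfl, (hs z).2 (Or.inl rfl)⟩
    · exact ⟨b, Or.inr rfl, h⟩

theorem IsZFCModel.pairIn_iff (hM : IsZFCModel M) {p a b : ↥M} :
    PairIn p a b ↔ p.1 = ZFSet.pair a.1 b.1 := by
  have h1 : ∀ z : ↥M, (∀ w : ↥M, w.1 ∈ z.1 ↔ w = a) ↔ z.1 = {a.1} := by
    refine fun z => ⟨fun h => ZFSet.ext fun w => ?_, fun h w => by simp [h, Subtype.ext_iff]⟩
    rw [ZFSet.mem_singleton]
    exact ⟨fun hw => congrArg Subtype.val ((h ⟨w, hM.1 _ z.2 _ hw⟩).1 hw),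
      fun hw => hw ▸ (h a).2 rfl⟩
  have h2 : ∀ z : ↥M, (∀ w : ↥M, w.1 ∈ z.1 ↔ w = a ∨ w = b) ↔ z.1 = {a.1, b.1} := by
    refine fun z => ⟨fun h => ZFSet.ext fun w => ?_, fun h w => by simp [h, Subtype.ext_iff]⟩
    rw [ZFSet.mem_pair]
    constructor
    · exact fun hw => ((h ⟨w, hM.1 _ z.2 _ hw⟩).1 hw).imp (congrArg Subtype.val)
        (congrArg Subtype.val)
    · rintro (rfl | rfl)
      exacts [(h a).2 (Or.inl rfl), (h b).2 (Or.inr rfl)]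
  simp only [PairIn, h1, h2]
  refine ⟨fun h => ZFSet.ext fun w => ?_, fun h w => by simp [h, ZFSet.pair]⟩
  rw [ZFSet.pair, ZFSet.mem_pair]
  constructor
  · exact fun hw => (h ⟨w, hM.1 _ p.2 _ hw⟩).1 hw
  · obtain ⟨s, hs⟩ := hM.exists_upair a a
    obtain ⟨t, ht⟩ := hM.exists_upair a b
    rintro (rfl | rfl)
    · have := (h1 s).1 (by simpa using hs)
      exact this ▸ (h s).2 (Or.inl this)
    · have := (h2 t).1 ht
      exact this ▸ (h t).2 (Or.inr this)

theorem IsZFCModel.exists_pairIn (hM : IsZFCModel M) (a b : ↥M) : ∃ p : ↥M, PairIn p a b := by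
  obtain ⟨s, hs⟩ := hM.exists_upair a a
  obtain ⟨t, ht⟩ := hM.exists_upair a b
  obtain ⟨p, hp⟩ := hM.exists_upair s t
  refine ⟨p, fun z => ?_⟩
  rw [hp]
  refine or_congr ⟨?_, fun h => hM.ext fun w => ?_⟩ ⟨?_, fun h => hM.ext fun w => ?_⟩
  · rintro rfl
    simpa using hs
  · rw [h, hs, or_self]
  · rintro rfl
    exact ht
  · rw [h, ht]

theorem IsZFCModel.pairIn_inj (hM : IsZFCModel M) {p a b a' b' : ↥M} (h : PairIn p a b)
    (h' : PairIn p a' b') : a = a' ∧ b = b' := by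
  rw [hM.pairIn_iff] at h h'
  simpa [Subtype.ext_iff] using ZFSet.pair_injective (h.symm.trans h')

theorem IsZFCModel.pairIn_unique (hM : IsZFCModel M) {p q a b : ↥M} (h : PairIn p a b)
    (h' : PairIn q a b) : p = q := by
  rw [hM.pairIn_iff] at h h'
  exact Subtype.ext (h.trans h'.symm)

theorem SetTransitive.ordinalIn_iff (hM : SetTransitive M) {x : ↥M} :
    OrdinalIn x ↔ x.1.IsOrdinal := by
  constructor
  · rintro ⟨h1, h2⟩
    refine ⟨fun y hy z hz => ?_, fun {y z w} hy hz hw => ?_⟩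
    · have hy' := hM _ x.2 _ hy
      exact h1 ⟨y, hy'⟩ hy ⟨z, hM _ hy' _ hz⟩ hz
    · have hw' := hM _ x.2 _ hw
      have hz' := hM _ hw' _ hz
      exact h2 ⟨w, hw'⟩ hw ⟨z, hz'⟩ hz ⟨y, hM _ hz' _ hy⟩ hy
  · exact fun h => ⟨fun y hy z hz => h.mem_trans hz hy,
      fun y hy z hz w hw => h.mem_trans' hw hz hy⟩

/-- A predicate is first-order definable over `M` with parameters. -/
def DefinablePred (P : ↥M → Prop) : Prop :=
  ∀ {n : ℕ} {f : (Fin n → ↥M) → ↥M}, NamedAlike id f f →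
    DefinedAlike id (fun v => P (f v)) (fun v => P (f v))

/-- A binary relation is first-order definable over `M` with parameters. -/
def DefinableRel (R : ↥M → ↥M → Prop) : Prop :=
  ∀ {n : ℕ} {f g : (Fin n → ↥M) → ↥M}, NamedAlike id f f → NamedAlike id g g →
    DefinedAlike id (fun v => R (f v) (g v)) (fun v => R (f v) (g v))

theorem IsZFCModel.exists_sep (hM : IsZFCModel M) {P : ↥M → Prop} (hP : DefinablePred P)
    (a : ↥M) : ∃ b : ↥M, ∀ x : ↥M, x.1 ∈ b.1 ↔ x.1 ∈ a.1 ∧ P x :=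
  hM.separation (hP (NamedAlike.var 0)) a

theorem IsZFCModel.replacement (hM : IsZFCModel M) {R : ↥M → ↥M → Prop} (hR : DefinableRel R)
    (a : ↥M) (h : ∀ x : ↥M, x.1 ∈ a.1 → ∀ y y', R x y → R x y' → y = y') :
    ∃ b : ↥M, ∀ y : ↥M, y.1 ∈ b.1 ↔ ∃ x : ↥M, x.1 ∈ a.1 ∧ R x y := by
  obtain ⟨b, hb⟩ := hM.collection (hR (NamedAlike.var 0) (NamedAlike.var 1)) a
  obtain ⟨c, hc⟩ := hM.exists_sep (P := fun y => ∃ x : ↥M, x.1 ∈ a.1 ∧ R x y) (fun hf =>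
    .ex <| .and (.mem (.var _) (.constId _)) (hR (.var _) (.reindex hf))) b
  refine ⟨c, fun y => (hc y).trans (and_iff_right_of_imp ?_)⟩
  rintro ⟨x, hx, hxy⟩
  obtain ⟨y', hy', hxy'⟩ := hb x hx ⟨y, hxy⟩
  rwa [h x hx y y' hxy hxy']

/-- A choice function for the nonempty subsets of `x`. -/
theorem IsZFCModel.exists_choice (hM : IsZFCModel M) (x : ↥M) :
    ∃ c : ↥M, ∀ u : ↥M, (∀ w : ↥M, w.1 ∈ u.1 → w.1 ∈ x.1) →
      ((∃ w : ↥M, w.1 ∈ u.1) → ∃ w : ↥M, w.1 ∈ u.1 ∧ PairMemIn u w c) ∧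
      ∀ w w' : ↥M, w.1 ∈ u.1 → w'.1 ∈ u.1 → PairMemIn u w c → PairMemIn u w' c → w = w' := by
  let Q : ↥M → ↥M → Prop := fun u z =>
    (∀ p : ↥M, p.1 ∈ z.1 ↔ ∃ w : ↥M, w.1 ∈ u.1 ∧ PairIn p u w) ∧ ∃ w : ↥M, w.1 ∈ u.1
  have hQ : DefinableRel Q := by
    intro n f g hf hg
    repeat' first
      | exact NamedAlike.var _ | exact NamedAlike.constId _ | assumption
      | exact NamedAlike.reindex (by assumption) | apply DefinedAlike.pairIn
      | apply DefinedAlike.and | apply DefinedAlike.all | apply DefinedAlike.iff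
      | apply DefinedAlike.mem | apply DefinedAlike.ex
  obtain ⟨P, hP⟩ := hM.exists_powerset x
  obtain ⟨F, hF⟩ := hM.replacement hQ P fun u _ z z' h h' =>
    hM.ext fun p => (h.1 p).trans (h'.1 p).symm
  have hne : ∀ z : ↥M, z.1 ∈ F.1 → ∃ p : ↥M, p.1 ∈ z.1 := by
    intro z hz
    obtain ⟨u, hu, h1, w, hw⟩ := (hF z).1 hz
    obtain ⟨p, hp⟩ := hM.exists_pairIn u w
    exact ⟨p, (h1 p).2 ⟨w, hw, hp⟩⟩
  obtain ⟨c, hc⟩ := hM.exists_transversal hne (by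
    intro z z' hz hz' hzz p hp hp'
    obtain ⟨u, hu, h1, -⟩ := (hF z).1 hz
    obtain ⟨u', hu', h1', -⟩ := (hF z').1 hz'
    obtain ⟨w, -, hw⟩ := (h1 p).1 hp
    obtain ⟨w', -, hw'⟩ := (h1' p).1 hp'
    obtain rfl := (hM.pairIn_inj hw hw').1
    exact hzz (hM.ext fun q => (h1 q).trans (h1' q).symm))
  have key : ∀ u : ↥M, (∀ w : ↥M, w.1 ∈ u.1 → w.1 ∈ x.1) → (∃ w : ↥M, w.1 ∈ u.1) →
      ∃ z : ↥M, z.1 ∈ F.1 ∧ ∀ p : ↥M, p.1 ∈ z.1 ↔ ∃ w : ↥M, w.1 ∈ u.1 ∧ PairIn p u w := by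
    intro u hu hw
    obtain ⟨z, hz⟩ := hM.replacement (R := fun w p => PairIn p u w)
      (fun hf hg => .pairIn hg (.constId _) hf) u fun w _ p p' h h' => hM.pairIn_unique h h'
    exact ⟨z, (hF z).2 ⟨u, (hP u).2 hu, hz, hw⟩, hz⟩
  refine ⟨c, fun u hu => ⟨fun hw => ?_, fun w w' hw hw' h h' => ?_⟩⟩
  · obtain ⟨z, hzF, hz⟩ := key u hu hw
    obtain ⟨p, ⟨hpz, hpc⟩, -⟩ := hc z hzF
    obtain ⟨w, hw, hp⟩ := (hz p).1 hpz
    exact ⟨w, hw, p, hp, hpc⟩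
  · obtain ⟨z, hzF, hz⟩ := key u hu ⟨w, hw⟩
    obtain ⟨p, hp, hpc⟩ := h
    obtain ⟨p', hp', hpc'⟩ := h'
    obtain ⟨q, -, hq⟩ := hc z hzF
    have h1 := hq p ((hz p).2 ⟨w, hw, hp⟩) hpc
    have h2 := hq p' ((hz p').2 ⟨w', hw', hp'⟩) hpc'
    obtain rfl := h1.trans h2.symm
    exact (hM.pairIn_inj hp hp').2

/-- `g` is a partial enumeration of `x`, indexed by an initial segment of the ordinals, whose
value at `ξ` is the element that `c` chooses from what remains of `x` at stage `ξ`. -/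
def IsAttempt (x c g : ↥M) : Prop :=
  ∀ ξ y : ↥M, PairMemIn ξ y g → OrdinalIn ξ ∧
    (∀ η : ↥M, η.1 ∈ ξ.1 → ∃ w, PairMemIn η w g) ∧
    ∃ u : ↥M, (∀ w : ↥M, w.1 ∈ u.1 ↔ w.1 ∈ x.1 ∧ ¬ ∃ η : ↥M, η.1 ∈ ξ.1 ∧ PairMemIn η w g) ∧
      y.1 ∈ u.1 ∧ PairMemIn u y c

theorem definablePred_isAttempt (x c : ↥M) : DefinablePred (IsAttempt x c) := by
  intro n f hf
  unfold IsAttempt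
  repeat' first
    | exact NamedAlike.var _ | exact NamedAlike.constId _ | assumption
    | exact NamedAlike.reindex (by assumption) | apply DefinedAlike.pairMemIn
    | apply DefinedAlike.ordinalIn | apply DefinedAlike.and | apply DefinedAlike.all
    | apply DefinedAlike.ex | apply DefinedAlike.iff | apply DefinedAlike.not
    | apply DefinedAlike.imp | apply DefinedAlike.mem

theorem IsZFCModel.isAttempt_unique (hM : IsZFCModel M) {x c : ↥M}
    (hc : ∀ u : ↥M, (∀ w : ↥M, w.1 ∈ u.1 → w.1 ∈ x.1) → ∀ w w' : ↥M, w.1 ∈ u.1 → w'.1 ∈ u.1 →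
      PairMemIn u w c → PairMemIn u w' c → w = w') {g g' : ↥M}
    (hg : IsAttempt x c g) (hg' : IsAttempt x c g') (ξ : ↥M) :
    ∀ y y', PairMemIn ξ y g → PairMemIn ξ y' g' → y = y' := by
  obtain ⟨ξ, hξ⟩ := ξ
  induction ξ using ZFSet.inductionOn with
  | _ ξ ih =>
    intro y y' hy hy'
    obtain ⟨-, h2, u, hu, hyu, hyc⟩ := hg _ _ hy
    obtain ⟨-, h2', u', hu', hyu', hyc'⟩ := hg' _ _ hy'
    have : u = u' := by
      refine hM.ext fun w => ?_
      rw [hu, hu']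
      refine and_congr_right fun _ => not_congr ⟨?_, ?_⟩
      · rintro ⟨η, hη, hw⟩
        obtain ⟨w', hw'⟩ := h2' η hη
        exact ⟨η, hη, ih η hη η.2 w w' hw hw' ▸ hw'⟩
      · rintro ⟨η, hη, hw⟩
        obtain ⟨w', hw'⟩ := h2 η hη
        exact ⟨η, hη, ih η hη η.2 w' w hw' hw ▸ hw'⟩
    subst this
    exact hc u (fun w hw => ((hu w).1 hw).1) y y' hyu hyu' hyc hyc'

/-- The ordinals of a model do not form a set in it. -/
theorem IsZFCModel.exists_ordinal_notMem (hM : IsZFCModel M) (b : ↥M) :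
    ∃ ξ : ↥M, OrdinalIn ξ ∧ ξ.1 ∉ b.1 ∧ ∀ η : ↥M, η.1 ∈ ξ.1 → η.1 ∈ b.1 := by
  have h : ∃ ξ : ↥M, OrdinalIn ξ ∧ ξ.1 ∉ b.1 := by
    by_contra! h
    obtain ⟨o, ho⟩ := hM.exists_sep (P := OrdinalIn) DefinedAlike.ordinalIn b
    have ho' : ∀ z : ↥M, z.1 ∈ o.1 ↔ z.1.IsOrdinal := fun z =>
      (ho z).trans ⟨fun hz => hM.1.ordinalIn_iff.1 hz.2,
        fun hz => ⟨h z (hM.1.ordinalIn_iff.2 hz), hM.1.ordinalIn_iff.2 hz⟩⟩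
    have ho'' : ∀ z ∈ o.1, z.IsOrdinal := fun z hz => (ho' ⟨z, hM.1 _ o.2 _ hz⟩).1 hz
    have : o.1.IsOrdinal := ZFSet.isOrdinal_iff_forall_mem_isOrdinal.2
      ⟨fun y hy z hz =>
        (ho' ⟨z, hM.1 _ (hM.1 _ o.2 _ hy) _ hz⟩).2 ((ho'' y hy).mem hz), ho''⟩
    exact ZFSet.mem_irrefl _ ((ho' o).2 this)
  have wf : WellFounded fun a b : ↥M => a.1 ∈ b.1 := InvImage.wf Subtype.val ZFSet.mem_wf
  obtain ⟨ξ, ⟨hξ, hξb⟩, hmin⟩ := wf.has_min {ξ : ↥M | OrdinalIn ξ ∧ ξ.1 ∉ b.1} h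
  refine ⟨ξ, hξ, hξb, fun η hη => ?_⟩
  by_contra hb
  exact hmin η ⟨hM.1.ordinalIn_iff.2 ((hM.1.ordinalIn_iff.1 hξ).mem hη), hb⟩ hη

/-- The well-ordering theorem inside a transitive model: every set of the model is enumerated
by ordinals, by a function of the model. -/
theorem IsZFCModel.exists_enumeration (hM : IsZFCModel M) (x : ↥M) :
    ∃ f : ↥M, (∀ ξ y y' : ↥M, PairMemIn ξ y f → PairMemIn ξ y' f → y = y') ∧
      (∀ ξ y : ↥M, PairMemIn ξ y f → y.1 ∈ x.1) ∧
      ∀ y : ↥M, y.1 ∈ x.1 → ∃ ξ : ↥M, OrdinalIn ξ ∧ PairMemIn ξ y f := by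
  obtain ⟨c, hc⟩ := hM.exists_choice x
  have huniq : ∀ {g g' : ↥M}, IsAttempt x c g → IsAttempt x c g' → ∀ ξ y y' : ↥M,
      PairMemIn ξ y g → PairMemIn ξ y' g' → y = y' := fun hg hg' =>
    hM.isAttempt_unique (fun u hu => (hc u hu).2) hg hg'
  let V : ↥M → ↥M → Prop := fun ξ y => ∃ g : ↥M, IsAttempt x c g ∧ PairMemIn ξ y g
  have hV : DefinableRel V := fun hf hg =>
    .ex <| .and (definablePred_isAttempt x c (.var _)) (.pairMemIn (.reindex hf) (.reindex hg)
      (.var _))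
  have hVfun : ∀ ξ y y', V ξ y → V ξ y' → y = y' :=
    fun ξ y y' ⟨g, hg, h⟩ ⟨g', hg', h'⟩ => huniq hg hg' ξ y y' h h'
  have hVmem : ∀ ξ y, V ξ y → y.1 ∈ x.1 := by
    rintro ξ y ⟨g, hg, h⟩
    obtain ⟨-, -, u, hu, hy, -⟩ := hg _ _ h
    exact ((hu y).1 hy).1
  have hVord : ∀ ξ y, V ξ y → OrdinalIn ξ := fun ξ y ⟨g, hg, h⟩ => (hg _ _ h).1
  have hVne : ∀ ξ ξ' y, V ξ y → V ξ' y → ξ.1 ∉ ξ'.1 := by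
    rintro ξ ξ' y hy ⟨g, hg, h⟩ hξ
    obtain ⟨-, h2, u, hu, hyu, -⟩ := hg _ _ h
    obtain ⟨w, hw⟩ := h2 ξ hξ
    obtain rfl := hVfun ξ w y ⟨g, hg, hw⟩ hy
    exact ((hu w).1 hyu).2 ⟨ξ, hξ, hw⟩
  have hVinj : ∀ ξ ξ' y, V ξ y → V ξ' y → ξ = ξ' := by
    intro ξ ξ' y h h'
    rcases (hM.1.ordinalIn_iff.1 (hVord _ _ h)).mem_trichotomous
      (hM.1.ordinalIn_iff.1 (hVord _ _ h')) with h1 | h1 | h1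
    · exact (hVne _ _ _ h h' h1).elim
    · exact Subtype.ext h1
    · exact (hVne _ _ _ h' h h1).elim
  obtain ⟨b, hb⟩ := hM.replacement (R := fun y ξ => V ξ y) (fun hf hg => hV hg hf) x
    fun y _ ξ ξ' => hVinj ξ ξ' y
  obtain ⟨ξ, hξ, hξb, hξmin⟩ := hM.exists_ordinal_notMem b
  have hdom : ∀ η : ↥M, η.1 ∈ ξ.1 → ∃ y, V η y := fun η hη =>
    let ⟨y, _, hy⟩ := (hb η).1 (hξmin η hη)
    ⟨y, hy⟩
  obtain ⟨f, hf⟩ := hM.replacement (R := fun η p => ∃ y, V η y ∧ PairIn p η y)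
    (fun hf hg => .ex <| .and (hV (.reindex hf) (.var _))
      (.pairIn (.reindex hg) (.reindex hf) (.var _))) ξ
    (fun η _ p p' ⟨y, hy, hp⟩ ⟨y', hy', hp'⟩ =>
      hM.pairIn_unique hp (hVfun _ _ _ hy hy' ▸ hp'))
  have hf' : ∀ η y : ↥M, PairMemIn η y f ↔ η.1 ∈ ξ.1 ∧ V η y := by
    refine fun η y => ⟨?_, ?_⟩
    · rintro ⟨p, hp, hpf⟩
      obtain ⟨η', hη', y', hy', hp'⟩ := (hf p).1 hpf
      obtain ⟨rfl, rfl⟩ := hM.pairIn_inj hp hp'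
      exact ⟨hη', hy'⟩
    · rintro ⟨hη, hy⟩
      obtain ⟨p, hp⟩ := hM.exists_pairIn η y
      exact ⟨p, hp, (hf p).2 ⟨η, hη, y, hy, hp⟩⟩
  refine ⟨f, fun η y y' h h' => hVfun η y y' ((hf' _ _).1 h).2 ((hf' _ _).1 h').2,
    fun η y h => hVmem η y ((hf' _ _).1 h).2, ?_⟩
  by_contra! hcon
  obtain ⟨y₀, hy₀, hy₀f⟩ := hcon
  obtain ⟨u, hu⟩ := hM.exists_sep (P := fun w => ¬ ∃ η : ↥M, η.1 ∈ ξ.1 ∧ PairMemIn η w f)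
    (fun hf => .not <| .ex <| .and (.mem (.var _) (.constId _))
      (.pairMemIn (.var _) (.reindex hf) (.constId _))) x
  have hux : ∀ w : ↥M, w.1 ∈ u.1 → w.1 ∈ x.1 := fun w hw => ((hu w).1 hw).1
  obtain ⟨w₀, hw₀, hw₀c⟩ := (hc u hux).1 ⟨y₀, (hu y₀).2 ⟨hy₀, fun ⟨η, hη, h⟩ =>
    hy₀f η (hVord η y₀ ((hf' _ _).1 h).2) h⟩⟩
  obtain ⟨q, hq⟩ := hM.exists_pairIn ξ w₀
  obtain ⟨g, hg⟩ := hM.exists_insert q f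
  have hg' : ∀ η y : ↥M, PairMemIn η y g ↔ η = ξ ∧ y = w₀ ∨ η.1 ∈ ξ.1 ∧ V η y := by
    intro η y
    rw [← hf']
    constructor
    · rintro ⟨p, hp, hpg⟩
      obtain rfl | hpf := (hg p).1 hpg
      · exact Or.inl (hM.pairIn_inj hp hq)
      · exact Or.inr ⟨p, hp, hpf⟩
    · rintro (⟨rfl, rfl⟩ | ⟨p, hp, hpf⟩)
      · exact ⟨q, hq, (hg q).2 (Or.inl rfl)⟩
      · exact ⟨p, hp, (hg p).2 (Or.inr hpf)⟩
  have hgξ : ∀ η y : ↥M, η.1 ∈ ξ.1 → (PairMemIn η y g ↔ V η y) := by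
    intro η y hη
    rw [hg', and_iff_right hη]
    refine or_iff_right fun h => ?_
    rw [h.1] at hη
    exact ZFSet.mem_irrefl _ hη
  have hgA : IsAttempt x c g := by
    intro η y hy
    obtain ⟨rfl, rfl⟩ | ⟨hη, g₀, hg₀, hy₀⟩ := (hg' η y).1 hy
    · refine ⟨hξ, fun ζ hζ => ?_, u, fun w => ?_, hw₀, hw₀c⟩
      · obtain ⟨w, hw⟩ := hdom ζ hζ
        exact ⟨w, (hgξ ζ w hζ).2 hw⟩
      · rw [hu]
        refine and_congr_right fun _ => not_congr <| exists_congr fun ζ =>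
          and_congr_right fun hζ => ?_
        rw [hgξ ζ w hζ, hf', and_iff_right hζ]
    · obtain ⟨h1, h2, u', hu', hyu, hyc⟩ := hg₀ _ _ hy₀
      have htr : ∀ ζ : ↥M, ζ.1 ∈ η.1 → ζ.1 ∈ ξ.1 := hξ.1 η hη
      refine ⟨h1, fun ζ hζ => ?_, u', fun w => ?_, hyu, hyc⟩
      · obtain ⟨w, hw⟩ := hdom ζ (htr ζ hζ)
        exact ⟨w, (hgξ ζ w (htr ζ hζ)).2 hw⟩
      · rw [hu']
        refine and_congr_right fun _ => not_congr <| exists_congr fun ζ =>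
          and_congr_right fun hζ => ?_
        rw [hgξ ζ w (htr ζ hζ)]
        refine ⟨fun hw => ⟨g₀, hg₀, hw⟩, fun hw => ?_⟩
        obtain ⟨w', hw'⟩ := h2 ζ hζ
        rwa [hVfun ζ w w' hw ⟨g₀, hg₀, hw'⟩]
  exact hξb ((hb ξ).2 ⟨w₀, hux _ hw₀, g, hgA, (hg' _ _).2 (Or.inl ⟨rfl, rfl⟩)⟩)

theorem IsZFCModel.exists_superset_of_finite (hM : IsZFCModel M) {s : Set ↥M} (hs : s.Finite) :
    ∃ b : ↥M, ∀ z ∈ s, z.1 ∈ b.1 := by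
  induction s, hs using Set.Finite.induction_on with
  | empty =>
    have := hM.2.realize_of_mem infAx (by simp [ZFCTheory])
    simp only [infAx, Sentence.Realize, Formula.Realize] at this
    rw [BoundedFormula.realize_ex] at this
    obtain ⟨b, -⟩ := this
    exact ⟨b, by simp⟩
  | @insert a s _ _ ih =>
    obtain ⟨b, hb⟩ := ih
    obtain ⟨c, hc⟩ := hM.exists_insert a b
    exact ⟨c, fun z hz => (hc z).2 (hz.imp_right (hb z))⟩

theorem IsZFCModel.infinite_ordinals (hM : IsZFCModel M) :
    {ξ : ↥M | ξ.1.IsOrdinal}.Infinite := by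
  intro hfin
  obtain ⟨b, hb⟩ := hM.exists_superset_of_finite hfin
  obtain ⟨ξ, hξ, hξb, -⟩ := hM.exists_ordinal_notMem b
  exact hξb (hb ξ (hM.1.ordinalIn_iff.1 hξ))

end Model

section Embedding

variable {M N : Set ZFSet.{u}}

theorem mem_iff_map_mem (j : ↥M ↪ₑ[ZFLang] ↥N) (x y : ↥M) : x.1 ∈ y.1 ↔ (j x).1 ∈ (j y).1 :=
  DefinedAlike.transfer (.mem (.const x) (.const y))

theorem map_isOrdinal (hM : SetTransitive M) (hN : SetTransitive N) (j : ↥M ↪ₑ[ZFLang] ↥N)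
    (x : ↥M) (hx : x.1.IsOrdinal) : (j x).1.IsOrdinal :=
  hN.ordinalIn_iff.1 <| (DefinedAlike.transfer (.ordinalIn (.const x))).1 <| hM.ordinalIn_iff.2 hx

/-- An elementary embedding between transitive models of ZFC with the same ordinals is trivial
if it fixes every ordinal. -/
theorem map_eq_of_fixes_ordinals (hM : IsZFCModel M) (hN : IsZFCModel N)
    (hNM : ∀ x : ZFSet, x.IsOrdinal → x ∈ N → x ∈ M) (j : ↥M ↪ₑ[ZFLang] ↥N)
    (hj : ∀ ξ : ↥M, ξ.1.IsOrdinal → (j ξ).1 = ξ.1) (x : ↥M) : (j x).1 = x.1 := by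
  obtain ⟨x, hx⟩ := x
  induction x using ZFSet.inductionOn with
  | _ x ih =>
    refine ZFSet.ext fun y => ⟨fun hy => ?_, fun hy => ?_⟩
    · obtain ⟨f, hfun, hfx, hsurj⟩ := hM.exists_enumeration ⟨x, hx⟩
      have hfun' : ∀ ξ y y' : ↥N, PairMemIn ξ y (j f) → PairMemIn ξ y' (j f) → y = y' := by
        refine (DefinedAlike.transfer (j := j) ?_).1 hfun
        repeat' first
          | exact NamedAlike.var _ | exact NamedAlike.const _ | apply DefinedAlike.pairMemIn
          | apply DefinedAlike.all | apply DefinedAlike.imp | apply DefinedAlike.eq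
      have hsurj' : ∀ y : ↥N, y.1 ∈ (j ⟨x, hx⟩).1 → ∃ ξ : ↥N, OrdinalIn ξ ∧
          PairMemIn ξ y (j f) := by
        refine (DefinedAlike.transfer (j := j) ?_).1 hsurj
        repeat' first
          | exact NamedAlike.var _ | exact NamedAlike.const _ | apply DefinedAlike.pairMemIn
          | apply DefinedAlike.ordinalIn | apply DefinedAlike.all | apply DefinedAlike.imp
          | apply DefinedAlike.ex | apply DefinedAlike.and | apply DefinedAlike.mem
      have hyN : y ∈ N := hN.1 _ (j ⟨x, hx⟩).2 _ hy
      obtain ⟨ξ, hξ, hξy⟩ := hsurj' ⟨y, hyN⟩ hy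
      rw [hN.1.ordinalIn_iff] at hξ
      let ξ' : ↥M := ⟨ξ.1, hNM _ hξ ξ.2⟩
      have hξ' : j ξ' = ξ := Subtype.ext (hj ξ' hξ)
      have hdom : (∃ y', PairMemIn ξ' y' f) ↔ ∃ y', PairMemIn (j ξ') y' (j f) :=
        DefinedAlike.transfer (j := j) (.ex (.pairMemIn (.const ξ') (.var _) (.const f)))
      obtain ⟨y', hy'⟩ := hdom.2 ⟨⟨y, hyN⟩, hξ'.symm ▸ hξy⟩
      have h1 := (DefinedAlike.transfer (j := j)
        (.pairMemIn (.const ξ') (.const y') (.const f))).1 hy'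
      rw [hξ'] at h1
      have h2 : y = (j y').1 := congrArg Subtype.val (hfun' ξ _ _ hξy h1)
      have h3 := hfx _ _ hy'
      rw [h2, ih y'.1 h3 y'.2]
      exact h3
    · have hyM := hM.1 _ hx _ hy
      have := (mem_iff_map_mem j ⟨y, hyM⟩ ⟨x, hx⟩).1 hy
      rwa [ih y hy hyM] at this

end Embedding

/-- A commuting system of strictly increasing self-maps of a well-order `X`, indexed by a linear
order in which every `X`-indexed family is bounded, is eventually constant. -/
theorem exists_forall_ge_eq_self_of_strictMono {I X : Type*} [LinearOrder I] [LinearOrder X]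
    [WellFoundedLT X] [Nonempty I] (hI : ∀ f : X → I, BddAbove (Set.range f)) (J : I → I → X → X)
    (hJ : ∀ α β, α ≤ β → StrictMono (J α β))
    (hcomp : ∀ α β γ, α ≤ β → β ≤ γ → ∀ x, J α γ x = J β γ (J α β x)) :
    ∃ α, ∀ β, α ≤ β → ∀ x, J α β x = x := by
  have hstab : ∀ α x, ∃ γ, α ≤ γ ∧ ∀ β, γ ≤ β → J α β x = J α γ x := by
    intro α x
    classical
    obtain ⟨γ, hγ⟩ := hI fun y => if h : ∃ β, α ≤ β ∧ J α β x = y then h.choose else α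
    have hγ' : ∀ β, α ≤ β → ∃ β', α ≤ β' ∧ β' ≤ γ ∧ J α β' x = J α β x := by
      intro β hβ
      have h : ∃ β', α ≤ β' ∧ J α β' x = J α β x := ⟨β, hβ, rfl⟩
      refine ⟨h.choose, h.choose_spec.1, ?_, h.choose_spec.2⟩
      have := hγ ⟨J α β x, rfl⟩
      beta_reduce at this
      rwa [dif_pos h] at this
    obtain ⟨δ, hαδ, hδγ, -⟩ := hγ' α le_rfl
    refine ⟨γ, hαδ.trans hδγ, fun β hβ => ?_⟩
    obtain ⟨β', h1, h2, h3⟩ := hγ' β ((hαδ.trans hδγ).trans hβ)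
    apply le_antisymm
    · rw [← h3, hcomp α β' γ h1 h2]
      exact (hJ _ _ h2).le_apply
    · rw [hcomp α γ β (hαδ.trans hδγ) hβ]
      exact (hJ _ _ hβ).le_apply
  choose G hαG hG using hstab
  let E : I → X → X := fun α x => J α (G α x) x
  have hE : ∀ α x β, G α x ≤ β → J α β x = E α x := hG
  have hEinj : ∀ α, Function.Injective (E α) := by
    intro α x y h
    rw [← hE α x (max (G α x) (G α y)) (le_max_left _ _),
      ← hE α y (max (G α x) (G α y)) (le_max_right _ _)] at h
    exact (hJ _ _ ((hαG α x).trans (le_max_left _ _))).injective h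
  have hEcomp : ∀ α β, α ≤ β → ∀ x, E α x = E β (J α β x) := by
    intro α β h x
    rw [← hE α x (max (G α x) (G β (J α β x))) (le_max_left _ _),
      ← hE β _ (max (G α x) (G β (J α β x))) (le_max_right _ _)]
    exact hcomp _ _ _ h ((hαG _ _).trans (le_max_right _ _)) x
  have hEle : ∀ α β, α ≤ β → ∀ x, E β x ≤ E α x := by
    intro α β h x
    rw [hEcomp α β h, ← hE β x (max (G β x) (G β (J α β x))) (le_max_left _ _),
      ← hE β _ (max (G β x) (G β (J α β x))) (le_max_right _ _)]
    exact (hJ _ _ ((hαG β x).trans (le_max_left _ _))).monotone (hJ _ _ h).le_apply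
  have hA : ∀ x, ∃ α, ∀ β, α ≤ β → E β x = E α x := by
    intro x
    obtain ⟨_, ⟨α, rfl⟩, hα⟩ := wellFounded_lt.has_min (Set.range fun α => E α x)
      (Set.range_nonempty _)
    exact ⟨α, fun β hβ => (hEle α β hβ x).antisymm (not_lt.1 (hα _ ⟨β, rfl⟩))⟩
  choose A hA using hA
  obtain ⟨α, hα⟩ := hI A
  refine ⟨α, fun β hβ x => hEinj β ?_⟩
  have hAα : A x ≤ α := hα ⟨x, rfl⟩
  rw [← hEcomp α β hβ, hA x α hAα, hA x β (hAα.trans hβ)]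

/-- Theorem 4.6: there is no commuting system of everywhere-nontrivial
elementary embeddings between transitive ZFC models with common class of ordinals `O`
(i.e. of height `δ = ot(O)`) indexed by the ordinals below `δ⁺ = |O|⁺`. -/
theorem stmt7 (O : Set ZFSet) (hO : ∀ x ∈ O, x.IsOrdinal) :
    ¬ ∃ (M : Set.Iio (Order.succ (Cardinal.mk ↥O)).ord → Set ZFSet)
        (j : ∀ α β : Set.Iio (Order.succ (Cardinal.mk ↥O)).ord,
          α ≤ β → (↥(M α) ↪ₑ[ZFLang] ↥(M β))),
      (∀ α, IsZFCModel (M α)) ∧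
      (∀ α, ∀ x : ZFSet, x.IsOrdinal → (x ∈ M α ↔ x ∈ O)) ∧
      (∀ α β γ (h1 : α ≤ β) (h2 : β ≤ γ) (x : ↥(M α)),
        j α γ (h1.trans h2) x = j β γ h2 (j α β h1 x)) ∧
      (∀ α β (h : α < β), ∃ x : ↥(M α),
        ((j α β h.le x : ↥(M β)) : ZFSet) ≠ (x : ZFSet)) := by
  rintro ⟨M, j, hM, hMO, hcomp, hnt⟩
  have hpos : (0 : Ordinal) < (Order.succ (Cardinal.mk ↥O)).ord :=
    Cardinal.ord_pos.2 (Order.bot_lt_succ _)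
  let α₀ : Set.Iio (Order.succ (Cardinal.mk ↥O)).ord := ⟨0, hpos⟩
  have hinf : Cardinal.aleph0 ≤ Cardinal.mk ↥O := by
    have := (hM α₀).infinite_ordinals.to_subtype
    refine Cardinal.aleph0_le_mk_iff.2 <| Infinite.of_injective
      (fun ξ : {ξ : ↥(M α₀) | ξ.1.IsOrdinal} => (⟨ξ.1.1, (hMO α₀ _ ξ.2).1 ξ.1.2⟩ : ↥O)) ?_
    intro ξ ξ' h
    exact Subtype.ext (Subtype.ext (congrArg (fun z : ↥O => z.1) h))
  have hreg := Cardinal.isRegular_succ hinf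
  have hlim := Cardinal.isSuccLimit_ord hreg.aleph0_le
  let lin : LinearOrder ↥O := LinearOrder.lift' (fun x => x.1.rank) fun x y h =>
    Subtype.ext ((ZFSet.IsOrdinal.rank_inj (hO _ x.2) (hO _ y.2)).1 h)
  have hlt : ∀ x y : ↥O, lin.lt x y ↔ x.1 ∈ y.1 := fun x y =>
    ZFSet.IsOrdinal.rank_lt_iff_mem (hO _ x.2) (hO _ y.2)
  have wf : @WellFoundedLT ↥O lin.toLT := ⟨InvImage.wf (fun x : ↥O => x.1.rank) wellFounded_lt⟩
  have hmem : ∀ α (x : ↥O), x.1 ∈ M α := fun α x => (hMO α _ (hO _ x.2)).2 x.2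
  have hmem' : ∀ α β (h : α ≤ β) (x : ↥O), (j α β h ⟨x.1, hmem α x⟩).1 ∈ O := fun α β h x =>
    (hMO β _ (map_isOrdinal (hM α).1 (hM β).1 _ _ (hO _ x.2))).1 (j α β h _).2
  classical
  have : Nonempty (Set.Iio (Order.succ (Cardinal.mk ↥O)).ord) := ⟨α₀⟩
  obtain ⟨α, hα⟩ := @exists_forall_ge_eq_self_of_strictMono
    (Set.Iio (Order.succ (Cardinal.mk ↥O)).ord) ↥O _ lin wf _ (fun f => by
      have hsup : ⨆ x, (f x).1 < (Order.succ (Cardinal.mk ↥O)).ord :=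
        Ordinal.iSup_lt_of_lt_cof (by rw [hreg.cof_ord]; exact Order.lt_succ _) fun x => (f x).2
      refine ⟨⟨_, hsup⟩, ?_⟩
      rintro _ ⟨x, rfl⟩
      exact Ordinal.le_iSup (fun x => (f x).1) x)
    (fun α β x => if h : α ≤ β then ⟨(j α β h ⟨x.1, hmem α x⟩).1, hmem' α β h x⟩ else x)
    (by
      intro α β h x y hxy
      simp only [dif_pos h]
      exact (hlt _ _).2 ((mem_iff_map_mem (j α β h) ⟨x.1, hmem α x⟩ ⟨y.1, hmem α y⟩).1
        ((hlt _ _).1 hxy)))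
    (by
      intro α β γ h h' x
      simp only [dif_pos h, dif_pos h', dif_pos (h.trans h')]
      exact Subtype.ext
        (congrArg (fun z : ↥(M γ) => z.1) (hcomp α β γ h h' ⟨x.1, hmem α x⟩)))
  let β : Set.Iio (Order.succ (Cardinal.mk ↥O)).ord := ⟨Order.succ α.1, hlim.succ_lt α.2⟩
  have hαβ : α < β := Order.lt_succ α.1
  obtain ⟨x, hx⟩ := hnt α β hαβ
  refine hx (map_eq_of_fixes_ordinals (hM α) (hM β)
    (fun x hx h => (hMO α x hx).2 ((hMO β x hx).1 h)) _ (fun ξ hξ => ?_) x)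
  have := hα β hαβ.le ⟨ξ.1, (hMO α _ hξ).1 ξ.2⟩
  rw [dif_pos hαβ.le] at this
  exact congrArg (fun z : ↥O => z.1) this
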